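/- For any orderons W and U and every simple ordered graph F on k vertices, |t(F,W) − t(F,U)| ≤ 2·k!·(k choose 2)·√(‖W − U‖_□). -/

import Mathlib

open MeasureTheory Real Filter
open scoped ENNReal Classical

noncomputable section

/-- The unit interval `[0,1]` as a subtype of `ℝ`. -/
abbrev UI : Type := Set.Icc (0:ℝ) 1

/-- The unit square `[0,1]²`. -/
abbrev USq : Type := UI × UI

/-- An orderon: a symmetric measurable function `([0,1]²)² → [0,1]`. -/
def IsOrderon (W : USq → USq → ℝ) : Prop :=
  Measurable (Function.uncurry W) ∧ (∀ u v, W u v ∈ Set.Icc (0:ℝ) 1) ∧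
    ∀ u v, W u v = W v u

/-- The (unordered) cut norm: `sup_{S,T} |∫_{S×T} W|` over measurable `S,T ⊆ [0,1]²`. -/
def cutNorm (W : USq → USq → ℝ) : ℝ :=
  sSup {x | ∃ S T : Set USq, MeasurableSet S ∧ MeasurableSet T ∧
    x = |∫ p in S ×ˢ T, W p.1 p.2|}

/-- The (induced) homomorphism density `t(F,W)` of a simple ordered graph `F` on `[k]`
(encoded as a `SimpleGraph (Fin k)`, the vertex order being that of `Fin k`) in `W`. -/
def homDensity {k : ℕ} (F : SimpleGraph (Fin k)) (W : USq → USq → ℝ) : ℝ :=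
  (k.factorial : ℝ) * ∫ v : Fin k → USq,
    ∏ p ∈ Finset.univ.filter (fun p : Fin k × Fin k => p.1 < p.2),
      ((if F.Adj p.1 p.2 then W (v p.1) (v p.2) else 1 - W (v p.1) (v p.2)) *
        (if ((v p.1).1 : ℝ) ≤ ((v p.2).1 : ℝ) then 1 else 0))


section CutNorm

variable {α β : Type*} [MeasurableSpace α] [MeasurableSpace β]

lemma integrable_of_abs_le {μ : Measure α} [IsFiniteMeasure μ] {f : α → ℝ} {C : ℝ}
    (hf : Measurable f) (hC : ∀ x, |f x| ≤ C) : Integrable f μ :=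
  Integrable.of_bound hf.aestronglyMeasurable C (ae_of_all _ hC)

/-- Weighting by a `[0,1]`-valued function is dominated by restricting to the positivity set. -/
lemma integral_mul_le_setIntegral_pos {μ : Measure α} {f φ : α → ℝ}
    (hf : Measurable f) (hf01 : ∀ x, f x ∈ Set.Icc (0 : ℝ) 1)
    (hφ : Measurable φ) (hφi : Integrable φ μ) :
    ∫ x, f x * φ x ∂μ ≤ ∫ x in {x | 0 < φ x}, φ x ∂μ := by
  have hS : MeasurableSet {x | 0 < φ x} := measurableSet_lt measurable_const hφ
  rw [← integral_indicator hS]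
  refine integral_mono (hφi.bdd_mul (c := 1) hf.aestronglyMeasurable (ae_of_all _ fun x => ?_))
    (hφi.indicator hS) fun x => ?_
  · rw [Real.norm_eq_abs, abs_of_nonneg (hf01 x).1]
    exact (hf01 x).2
  · by_cases h : 0 < φ x
    · simp only [Set.indicator, Set.mem_ofPred_eq, h, if_true]
      nlinarith [(hf01 x).2]
    · simp only [Set.indicator, Set.mem_ofPred_eq, h, if_false]
      nlinarith [(hf01 x).1]

lemma exists_integral_mul_mul_le_setIntegral {μ : Measure α} {ν : Measure β}
    [IsFiniteMeasure μ] [IsFiniteMeasure ν] {D : α × β → ℝ} {C : ℝ}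
    (hD : Measurable D) (hC : ∀ p, |D p| ≤ C) {f : α → ℝ} {g : β → ℝ}
    (hf : Measurable f) (hf01 : ∀ x, f x ∈ Set.Icc (0 : ℝ) 1)
    (hg : Measurable g) (hg01 : ∀ x, g x ∈ Set.Icc (0 : ℝ) 1) :
    ∃ S T, MeasurableSet S ∧ MeasurableSet T ∧
      ∫ p, D p * (f p.1 * g p.2) ∂(μ.prod ν) ≤ ∫ p in S ×ˢ T, D p ∂(μ.prod ν) := by
  have habs {t : ℝ} (ht : t ∈ Set.Icc (0 : ℝ) 1) : |t| ≤ 1 := by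
    rw [abs_of_nonneg ht.1]; exact ht.2
  have hDg : Integrable (fun p => D p * g p.2) (μ.prod ν) := by
    refine integrable_of_abs_le (C := C * 1) (by fun_prop) fun p => ?_
    rw [abs_mul]
    exact mul_le_mul (hC p) (habs (hg01 _)) (abs_nonneg _) ((abs_nonneg _).trans (hC p))
  have hDfg : Integrable (fun p => D p * (f p.1 * g p.2)) (μ.prod ν) := by
    refine integrable_of_abs_le (C := C * (1 * 1)) (by fun_prop) fun p => ?_
    rw [abs_mul, abs_mul]
    exact mul_le_mul (hC p) (mul_le_mul (habs (hf01 _)) (habs (hg01 _)) (abs_nonneg _) zero_le_one)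
      (by positivity) ((abs_nonneg _).trans (hC p))
  set φ : α → ℝ := fun x => ∫ y, D (x, y) * g y ∂ν with hφ_def
  have hDgm : Measurable fun p : α × β => D p * g p.2 := by fun_prop
  have hφ : Measurable φ :=
    (StronglyMeasurable.integral_prod_right (f := fun x y => D (x, y) * g y)
      hDgm.stronglyMeasurable).measurable
  set S : Set α := {x | 0 < φ x}
  have hS : MeasurableSet S := measurableSet_lt measurable_const hφ
  set ψ : β → ℝ := fun y => ∫ x in S, D (x, y) ∂μ with hψ_def
  have hψ : Measurable ψ :=
    (StronglyMeasurable.integral_prod_left (f := fun x y => D (x, y))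
      hD.stronglyMeasurable).measurable
  have hDS : Integrable D ((μ.restrict S).prod ν) := integrable_of_abs_le hD hC
  have hDgS : Integrable (fun p => D p * g p.2) ((μ.restrict S).prod ν) := by
    have := hDg.restrict (s := S ×ˢ Set.univ)
    rwa [← Measure.prod_restrict, Measure.restrict_univ] at this
  refine ⟨S, {y | 0 < ψ y}, hS, measurableSet_lt measurable_const hψ, ?_⟩
  calc ∫ p, D p * (f p.1 * g p.2) ∂(μ.prod ν)
      = ∫ x, f x * φ x ∂μ := by
        rw [integral_prod _ hDfg]
        refine integral_congr_ae (ae_of_all _ fun x => ?_)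
        simp only [hφ_def, ← integral_const_mul]
        exact integral_congr_ae (ae_of_all _ fun y => by ring)
    _ ≤ ∫ x in S, φ x ∂μ := integral_mul_le_setIntegral_pos hf hf01 hφ hDg.integral_prod_left
    _ = ∫ y, g y * ψ y ∂ν := by
        rw [hφ_def, integral_integral_swap (f := fun x y => D (x, y) * g y) hDgS]
        refine integral_congr_ae (ae_of_all _ fun y => ?_)
        simp only [hψ_def]
        rw [integral_mul_const, mul_comm]
    _ ≤ ∫ y in {y | 0 < ψ y}, ψ y ∂ν :=
        integral_mul_le_setIntegral_pos hg hg01 hψ hDS.integral_prod_right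
    _ = ∫ p in S ×ˢ {y | 0 < ψ y}, D p ∂(μ.prod ν) := by
        rw [← Measure.prod_restrict]
        exact (integral_prod_symm D (integrable_of_abs_le hD hC)).symm

lemma abs_setIntegral_le_cutNorm {D : USq → USq → ℝ} (hD1 : ∀ u v, |D u v| ≤ 1)
    {S T : Set USq} (hS : MeasurableSet S) (hT : MeasurableSet T) :
    |∫ p in S ×ˢ T, D p.1 p.2| ≤ cutNorm D := by
  refine le_csSup ⟨1, ?_⟩ ⟨S, T, hS, hT, rfl⟩
  rintro _ ⟨S, T, -, -, rfl⟩
  refine (norm_setIntegral_le_of_norm_le_const (C := 1) (measure_lt_top _ _)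
    fun (p : USq × USq) _ => (Real.norm_eq_abs (D p.1 p.2)).trans_le (hD1 p.1 p.2)).trans ?_
  simp

lemma cutNorm_nonneg (D : USq → USq → ℝ) : 0 ≤ cutNorm D :=
  Real.sSup_nonneg fun _ ⟨_, _, _, _, h⟩ => h ▸ abs_nonneg _

lemma abs_integral_mul_mul_le_cutNorm {D : USq → USq → ℝ}
    (hD : Measurable (Function.uncurry D)) (hD1 : ∀ u v, |D u v| ≤ 1) {f g : USq → ℝ}
    (hf : Measurable f) (hf01 : ∀ x, f x ∈ Set.Icc (0 : ℝ) 1)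
    (hg : Measurable g) (hg01 : ∀ x, g x ∈ Set.Icc (0 : ℝ) 1) :
    |∫ p : USq × USq, D p.1 p.2 * (f p.1 * g p.2)| ≤ cutNorm D := by
  have hD1' : ∀ p : USq × USq, |Function.uncurry D p| ≤ 1 := fun p => hD1 p.1 p.2
  refine abs_le'.2 ⟨?_, ?_⟩
  · obtain ⟨S, T, hS, hT, h⟩ := exists_integral_mul_mul_le_setIntegral (μ := volume)
      (ν := volume) hD hD1' hf hf01 hg hg01
    exact h.trans ((le_abs_self _).trans (abs_setIntegral_le_cutNorm hD1 hS hT))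
  · obtain ⟨S, T, hS, hT, h⟩ := exists_integral_mul_mul_le_setIntegral (μ := volume)
      (ν := volume) hD.neg (fun p => (abs_neg _).trans_le (hD1' p)) hf hf01 hg hg01
    simp only [Pi.neg_apply, neg_mul, integral_neg] at h
    exact h.trans ((neg_le_abs _).trans (abs_setIntegral_le_cutNorm hD1 hS hT))

end CutNorm

section Order

/-- The index of the block containing `x` when `[0,1]` is cut into `n + 1` equal intervals. -/
def block (n : ℕ) (x : UI) : ℕ := min ⌊(n + 1) * (x : ℝ)⌋₊ n

lemma block_mono (n : ℕ) : Monotone (block n) := fun x y h =>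
  min_le_min_right _ (Nat.floor_mono (mul_le_mul_of_nonneg_left h (by positivity)))

lemma measurable_block (n : ℕ) : Measurable (block n) :=
  (block_mono n).measurable

lemma volume_block_eq_le (n a : ℕ) : volume.real {x : UI | block n x = a} ≤ 1 / (n + 1) := by
  have hn : (0 : ℝ) < n + 1 := by positivity
  have hsub : Subtype.val '' {x : UI | block n x = a} ⊆
      Set.Icc (a / (n + 1) : ℝ) ((a + 1) / (n + 1)) := by
    rintro _ ⟨x, hx, rfl⟩
    have hx0 : (0 : ℝ) ≤ (n + 1) * x := mul_nonneg hn.le x.2.1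
    have h1 := Nat.floor_le hx0
    have h2 := Nat.lt_floor_add_one ((n + 1) * (x : ℝ))
    have h3 : (n + 1) * (x : ℝ) ≤ n + 1 := mul_le_of_le_one_right hn.le x.2.2
    rw [Set.mem_ofPred_eq, block] at hx
    rw [Set.mem_Icc, div_le_iff₀' hn, le_div_iff₀' hn]
    rcases le_total ⌊(n + 1) * (x : ℝ)⌋₊ n with h | h
    · rw [min_eq_left h] at hx
      rw [hx] at h1 h2
      exact ⟨h1, h2.le⟩
    · rw [min_eq_right h] at hx
      rw [← hx]
      exact ⟨(Nat.cast_le.2 h).trans h1, h3⟩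
  have hvol : volume {x : UI | block n x = a} ≤ ENNReal.ofReal (1 / (n + 1)) := by
    rw [Measure.Subtype.volume_def, (MeasurableEmbedding.subtype_coe measurableSet_Icc).comap_apply]
    refine (measure_mono hsub).trans_eq ?_
    rw [Real.volume_Icc]
    congr 1
    ring
  exact ENNReal.toReal_le_of_le_ofReal (by positivity) hvol

lemma integral_block_eq_le (n : ℕ) :
    ∫ p : USq × USq, (if block n p.1.1 = block n p.2.1 then (1 : ℝ) else 0) ≤ 1 / (n + 1) := by
  have hb := measurable_block n
  have hm : MeasurableSet {p : USq × USq | block n p.1.1 = block n p.2.1} :=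
    measurableSet_eq_fun (by fun_prop) (by fun_prop)
  have hi : Integrable (fun p : USq × USq =>
      if block n p.1.1 = block n p.2.1 then (1 : ℝ) else 0) :=
    integrable_of_abs_le (C := 1) (Measurable.ite hm measurable_const measurable_const)
      fun p => by split_ifs <;> simp
  rw [Measure.volume_eq_prod, integral_prod_symm _ hi]
  refine (integral_mono (hi.integral_prod_right) (integrable_const (1 / (n + 1) : ℝ))
    fun y => ?_).trans (by simp)
  have hset : MeasurableSet {x : USq | block n x.1 = block n y.1} :=
    measurableSet_eq_fun (by fun_prop) measurable_const
  have : ∫ x : USq, (if block n x.1 = block n y.1 then (1 : ℝ) else 0) =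
      volume.real {x : USq | block n x.1 = block n y.1} := by
    rw [← integral_indicator_one hset]
    simp [Set.indicator]
  refine this.trans_le ?_
  have hprod : {x : USq | block n x.1 = block n y.1} =
      {x : UI | block n x = block n y.1} ×ˢ Set.univ := by ext; simp
  rw [hprod, Measure.volume_eq_prod, measureReal_prod_prod]
  simpa using volume_block_eq_le n (block n y.1)

lemma ite_le_eq_sum_block (n : ℕ) (x y : UI) :
    (if (x : ℝ) ≤ y then (1 : ℝ) else 0) =
      ∑ a ∈ Finset.range n, (if block n x = a then (1 : ℝ) else 0) *
        (if a < block n y then 1 else 0) +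
      (if block n x = block n y then 1 else 0) * (if (x : ℝ) ≤ y then 1 else 0) := by
  have hsum : ∑ a ∈ Finset.range n, (if block n x = a then (1 : ℝ) else 0) *
      (if a < block n y then 1 else 0) = if block n x < block n y then 1 else 0 := by
    simp only [ite_mul, one_mul, zero_mul, Finset.sum_ite_eq, Finset.mem_range]
    have : block n y ≤ n := min_le_right _ _
    split_ifs <;> first | rfl | omega
  rw [hsum]
  rcases lt_trichotomy (block n x) (block n y) with h | h | h
  · have : (x : ℝ) ≤ y := ((block_mono n).reflect_lt h).le
    simp [h, h.ne, this]
  · simp [h]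
  · have : ¬ (x : ℝ) ≤ y := not_le.2 ((block_mono n).reflect_lt h)
    simp [h.not_gt, h.ne', this]

lemma le_two_mul_sqrt_of_forall_nat {x d : ℝ} (hd : 0 ≤ d)
    (h : ∀ n : ℕ, x ≤ n * d + 1 / (n + 1)) : x ≤ 2 * √d := by
  rcases hd.eq_or_lt with rfl | hd
  · simp only [mul_zero, zero_add] at h
    simpa using ge_of_tendsto' tendsto_one_div_add_atTop_nhds_zero_nat h
  · have hs : 0 < √d := Real.sqrt_pos.2 hd
    have h1 : (⌊1 / √d⌋₊ : ℝ) * d ≤ √d := by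
      calc (⌊1 / √d⌋₊ : ℝ) * d ≤ 1 / √d * d :=
            mul_le_mul_of_nonneg_right (Nat.floor_le (by positivity)) hd.le
        _ = √d := by rw [one_div_mul_eq_div, Real.div_sqrt]
    have h2 : 1 / ((⌊1 / √d⌋₊ : ℝ) + 1) ≤ √d := by
      rw [div_le_iff₀ (by positivity), ← div_le_iff₀' hs]
      exact (Nat.lt_floor_add_one _).le
    linarith [h ⌊1 / √d⌋₊]

lemma abs_integral_mul_ite_le_le {D : USq → USq → ℝ}
    (hD : Measurable (Function.uncurry D)) (hD1 : ∀ u v, |D u v| ≤ 1) {f g : USq → ℝ}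
    (hf : Measurable f) (hf01 : ∀ x, f x ∈ Set.Icc (0 : ℝ) 1)
    (hg : Measurable g) (hg01 : ∀ x, g x ∈ Set.Icc (0 : ℝ) 1) :
    |∫ p : USq × USq, D p.1 p.2 * (if (p.1.1 : ℝ) ≤ p.2.1 then 1 else 0) * (f p.1 * g p.2)| ≤
      2 * √(cutNorm D) := by
  refine le_two_mul_sqrt_of_forall_nat (cutNorm_nonneg D) fun n => ?_
  have hb := measurable_block n
  have hDm : Measurable fun p : USq × USq => D p.1 p.2 := hD
  have hle : Measurable fun p : USq × USq => if (p.1.1 : ℝ) ≤ p.2.1 then (1 : ℝ) else 0 :=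
    Measurable.ite (measurableSet_le (by fun_prop) (by fun_prop)) measurable_const measurable_const
  have heq : Measurable fun p : USq × USq =>
      if block n p.1.1 = block n p.2.1 then (1 : ℝ) else 0 :=
    Measurable.ite (measurableSet_eq_fun (by fun_prop) (by fun_prop)) measurable_const
      measurable_const
  set F : ℕ → USq → ℝ := fun a u => (if block n u.1 = a then 1 else 0) * f u with hF_def
  set G : ℕ → USq → ℝ := fun a u => (if a < block n u.1 then 1 else 0) * g u with hG_def
  have hF a : Measurable (F a) :=
    (Measurable.ite (measurableSet_eq_fun (by fun_prop) measurable_const) measurable_const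
      measurable_const).mul hf
  have hG a : Measurable (G a) :=
    (Measurable.ite (measurableSet_lt measurable_const (by fun_prop)) measurable_const
      measurable_const).mul hg
  have hF01 a u : F a u ∈ Set.Icc (0 : ℝ) 1 := by
    simp only [hF_def]; split_ifs <;> simp [(hf01 u).1, (hf01 u).2]
  have hG01 a u : G a u ∈ Set.Icc (0 : ℝ) 1 := by
    simp only [hG_def]; split_ifs <;> simp [(hg01 u).1, (hg01 u).2]
  have hDfg {f' g' : USq → ℝ} (hf01 : ∀ x, f' x ∈ Set.Icc (0 : ℝ) 1)
      (hg01 : ∀ x, g' x ∈ Set.Icc (0 : ℝ) 1) (p : USq × USq) :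
      |D p.1 p.2 * (f' p.1 * g' p.2)| ≤ 1 := by
    rw [abs_mul, abs_of_nonneg (mul_nonneg (hf01 _).1 (hg01 _).1)]
    exact mul_le_one₀ (hD1 _ _) (mul_nonneg (hf01 _).1 (hg01 _).1)
      (mul_le_one₀ (hf01 _).2 (hg01 _).1 (hg01 _).2)
  set R : USq × USq → ℝ := fun p =>
    (if block n p.1.1 = block n p.2.1 then 1 else 0) *
      ((if (p.1.1 : ℝ) ≤ p.2.1 then 1 else 0) * (D p.1 p.2 * (f p.1 * g p.2))) with hR_def
  have hRm : Measurable R := by fun_prop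
  have hR p : |R p| ≤ if block n p.1.1 = block n p.2.1 then 1 else 0 := by
    have := hDfg hf01 hg01 p
    simp only [hR_def]
    by_cases h : block n p.1.1 = block n p.2.1
    · rw [if_pos h, one_mul]
      split_ifs
      · rwa [one_mul]
      · simp
    · simp only [if_neg h, zero_mul, abs_zero, le_refl]
  have hind : Integrable (fun p : USq × USq =>
      if block n p.1.1 = block n p.2.1 then (1 : ℝ) else 0) :=
    integrable_of_abs_le (C := 1) heq fun p => by split_ifs <;> simp
  have hRi : Integrable R := hind.mono' hRm.aestronglyMeasurable (ae_of_all _ hR)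
  have hsplit (p : USq × USq) :
      D p.1 p.2 * (if (p.1.1 : ℝ) ≤ p.2.1 then 1 else 0) * (f p.1 * g p.2) =
        ∑ a ∈ Finset.range n, D p.1 p.2 * (F a p.1 * G a p.2) + R p := by
    rw [ite_le_eq_sum_block n, mul_add, add_mul, Finset.mul_sum, Finset.sum_mul]
    congr 1
    · exact Finset.sum_congr rfl fun a _ => by simp only [hF_def, hG_def]; ring
    · simp only [hR_def]; ring
  have hterm a : Integrable fun p : USq × USq => D p.1 p.2 * (F a p.1 * G a p.2) :=
    integrable_of_abs_le (by have := hF a; have := hG a; fun_prop) (hDfg (hF01 a) (hG01 a))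
  simp only [hsplit]
  rw [integral_add (integrable_finsetSum _ fun a _ => hterm a) hRi,
    integral_finsetSum _ fun a _ => hterm a]
  refine (abs_add_le _ _).trans (add_le_add ?_ ?_)
  · refine (Finset.abs_sum_le_sum_abs _ _).trans ((Finset.sum_le_sum fun a _ =>
      abs_integral_mul_mul_le_cutNorm hD hD1 (hF a) (hF01 a) (hG a) (hG01 a)).trans ?_)
    simp
  · exact (norm_integral_le_of_norm_le hind (f := R) (ae_of_all _ hR)).trans
      (integral_block_eq_le n)

end Order

section Counting

variable {ι : Type*} [Fintype ι] {X : Type*} [MeasurableSpace X]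

/-- Resampling one coordinate preserves a product of probability measures. -/
lemma measurePreserving_update (μ : Measure X) [IsProbabilityMeasure μ] (i : ι) :
    MeasurePreserving (fun q : (ι → X) × X => Function.update q.1 i q.2)
      ((Measure.pi fun _ => μ).prod μ) (Measure.pi fun _ => μ) := by
  refine ⟨measurable_update', (Measure.pi_eq fun s hs => ?_).symm⟩
  rw [Measure.map_apply measurable_update' (MeasurableSet.univ_pi hs)]
  have hpre : (fun q : (ι → X) × X => Function.update q.1 i q.2) ⁻¹' Set.univ.pi s =
      (Set.univ.pi (Function.update s i Set.univ)) ×ˢ s i := by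
    ext q
    simp only [Set.mem_preimage, Set.mem_univ_pi, Set.mem_prod]
    refine ⟨fun h => ⟨fun l => ?_, by simpa using h i⟩, fun h l => ?_⟩
    · rcases eq_or_ne l i with rfl | hl
      · simp
      · simpa [hl] using h l
    · rcases eq_or_ne l i with rfl | hl
      · simpa using h.2
      · simpa [hl] using h.1 l
  rw [hpre, Measure.prod_prod, Measure.pi_pi,
    ← Finset.prod_erase_mul Finset.univ (fun l => μ (s l)) (Finset.mem_univ i),
    ← Finset.prod_erase_mul Finset.univ _ (Finset.mem_univ i)]
  simp only [Function.update_self, measure_univ, mul_one]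
  congr 1
  exact Finset.prod_congr rfl fun l hl => by rw [Function.update_of_ne (Finset.ne_of_mem_erase hl)]

lemma abs_integral_pi_le_of_resample {μ : Measure X} [IsProbabilityMeasure μ] {h : (ι → X) → ℝ}
    {C : ℝ} (hm : Measurable h) (hC : ∀ v, |h v| ≤ C) (i j : ι) {ε : ℝ}
    (hε : ∀ v, |∫ p : X × X, h (Function.update (Function.update v i p.1) j p.2)
      ∂(μ.prod μ)| ≤ ε) :
    |∫ v, h v ∂(Measure.pi fun _ => μ)| ≤ ε := by
  have hmp : MeasurePreserving
      (fun q : (ι → X) × (X × X) => Function.update (Function.update q.1 i q.2.1) j q.2.2)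
      ((Measure.pi fun _ => μ).prod (μ.prod μ)) (Measure.pi fun _ => μ) :=
    ((measurePreserving_update μ j).comp
      ((measurePreserving_update μ i).prod (MeasurePreserving.id μ))).comp
      (measurePreserving_prodAssoc _ _ _).symm
  have hint : Integrable (fun q : (ι → X) × (X × X) =>
      h (Function.update (Function.update q.1 i q.2.1) j q.2.2))
      ((Measure.pi fun _ => μ).prod (μ.prod μ)) :=
    integrable_of_abs_le (hm.comp hmp.measurable) fun q => hC _
  rw [← hmp.map_eq, integral_map hmp.aemeasurable hm.aestronglyMeasurable, integral_prod _ hint]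
  simpa using norm_integral_le_of_norm_le_const (μ := Measure.pi fun _ : ι => μ)
    (f := fun v => ∫ p : X × X, h (Function.update (Function.update v i p.1) j p.2) ∂(μ.prod μ))
    (ae_of_all _ hε)

lemma prod_mem_Icc_zero_one {κ : Type*} (s : Finset κ) {c : κ → ℝ}
    (hc : ∀ l, c l ∈ Set.Icc (0 : ℝ) 1) : ∏ l ∈ s, c l ∈ Set.Icc (0 : ℝ) 1 :=
  ⟨Finset.prod_nonneg fun l _ => (hc l).1,
    Finset.prod_le_one (fun l _ => (hc l).1) fun l _ => (hc l).2⟩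

/-- If no pair in `Q` meets both `i` and `j`, the product over `Q` splits into a function of
`v i` and a function of `v j` when all other coordinates are fixed. -/
lemma abs_integral_mul_prod_le {μ : Measure X} [IsProbabilityMeasure μ]
    {D : X → X → ℝ} (hD : Measurable (Function.uncurry D)) {C : ℝ} (hC : ∀ u v, |D u v| ≤ C)
    {ε : ℝ}
    (hε : ∀ f g : X → ℝ, Measurable f → (∀ x, f x ∈ Set.Icc (0 : ℝ) 1) →
      Measurable g → (∀ x, g x ∈ Set.Icc (0 : ℝ) 1) →
      |∫ p : X × X, D p.1 p.2 * (f p.1 * g p.2) ∂(μ.prod μ)| ≤ ε)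
    (Q : Finset (ι × ι)) {c : ι × ι → X → X → ℝ} (hc : ∀ l, Measurable (Function.uncurry (c l)))
    (hc01 : ∀ l u v, c l u v ∈ Set.Icc (0 : ℝ) 1) {i j : ι} (hij : i ≠ j)
    (hQ : ∀ l ∈ Q, (l.1 ≠ i ∧ l.2 ≠ i) ∨ (l.1 ≠ j ∧ l.2 ≠ j)) :
    |∫ v : ι → X, D (v i) (v j) * ∏ l ∈ Q, c l (v l.1) (v l.2) ∂(Measure.pi fun _ => μ)| ≤ ε := by
  have hcm (l : ι × ι) : Measurable fun v : ι → X => c l (v l.1) (v l.2) :=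
    (hc l).comp (f := fun v : ι → X => (v l.1, v l.2)) (by fun_prop)
  have hprod (Q' : Finset (ι × ι)) : Measurable fun v : ι → X => ∏ l ∈ Q', c l (v l.1) (v l.2) :=
    Finset.measurable_fun_prod _ fun l _ => hcm l
  have hDm : Measurable fun v : ι → X => D (v i) (v j) :=
    hD.comp (f := fun v : ι → X => (v i, v j)) (by fun_prop)
  refine abs_integral_pi_le_of_resample (μ := μ) (C := C) (hDm.mul (hprod Q)) (fun v => ?_) i j
    fun v => ?_
  · have h01 := prod_mem_Icc_zero_one Q fun l => hc01 l (v l.1) (v l.2)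
    rw [Pi.mul_apply, abs_mul, abs_of_nonneg h01.1]
    exact (mul_le_of_le_one_right (abs_nonneg _) h01.2).trans (hC _ _)
  · set f : X → ℝ := fun a => ∏ l ∈ Q with l.1 ≠ j ∧ l.2 ≠ j,
      c l (Function.update v i a l.1) (Function.update v i a l.2)
    set g : X → ℝ := fun b => ∏ l ∈ Q with ¬ (l.1 ≠ j ∧ l.2 ≠ j),
      c l (Function.update v j b l.1) (Function.update v j b l.2)
    have hsplit (p : X × X) :
        D (Function.update (Function.update v i p.1) j p.2 i)
          (Function.update (Function.update v i p.1) j p.2 j) *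
          ∏ l ∈ Q, c l (Function.update (Function.update v i p.1) j p.2 l.1)
            (Function.update (Function.update v i p.1) j p.2 l.2) =
        D p.1 p.2 * (f p.1 * g p.2) := by
      rw [Function.update_of_ne hij, Function.update_self, Function.update_self,
        ← Finset.prod_filter_mul_prod_filter_not Q (fun l => l.1 ≠ j ∧ l.2 ≠ j)]
      congr 2
      · refine Finset.prod_congr rfl fun l hl => ?_
        obtain ⟨-, h1, h2⟩ := Finset.mem_filter.1 hl
        rw [Function.update_of_ne h1, Function.update_of_ne h2]
      · refine Finset.prod_congr rfl fun l hl => ?_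
        obtain ⟨hlQ, hl⟩ := Finset.mem_filter.1 hl
        obtain ⟨h1, h2⟩ := (hQ l hlQ).resolve_right hl
        rw [Function.update_comm hij, Function.update_of_ne h1, Function.update_of_ne h2]
    simp only [Pi.mul_apply, hsplit]
    exact hε f g ((hprod _).comp (measurable_update v))
      (fun a => prod_mem_Icc_zero_one _ fun l => hc01 l _ _)
      ((hprod _).comp (measurable_update v))
      (fun b => prod_mem_Icc_zero_one _ fun l => hc01 l _ _)

/-- Replacing the factors of a product over pairs one at a time. -/
lemma abs_integral_prod_sub_le [LinearOrder ι] {μ : Measure X} [IsProbabilityMeasure μ]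
    {P : Finset (ι × ι)} (hP : ∀ l ∈ P, l.1 < l.2) {A B : ι × ι → X → X → ℝ}
    (hA : ∀ l, Measurable (Function.uncurry (A l))) (hB : ∀ l, Measurable (Function.uncurry (B l)))
    (hA01 : ∀ l u v, A l u v ∈ Set.Icc (0 : ℝ) 1) (hB01 : ∀ l u v, B l u v ∈ Set.Icc (0 : ℝ) 1)
    {ε : ℝ}
    (hε : ∀ l, ∀ f g : X → ℝ, Measurable f → (∀ x, f x ∈ Set.Icc (0 : ℝ) 1) →
      Measurable g → (∀ x, g x ∈ Set.Icc (0 : ℝ) 1) →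
      |∫ p : X × X, (A l p.1 p.2 - B l p.1 p.2) * (f p.1 * g p.2) ∂(μ.prod μ)| ≤ ε) :
    |∫ v : ι → X, ∏ l ∈ P, A l (v l.1) (v l.2) ∂(Measure.pi fun _ => μ) -
      ∫ v : ι → X, ∏ l ∈ P, B l (v l.1) (v l.2) ∂(Measure.pi fun _ => μ)| ≤ P.card * ε := by
  set H : Finset (ι × ι) → ι × ι → X → X → ℝ := fun Q l => if l ∈ Q then A l else B l with hH_def
  have hH Q l : Measurable (Function.uncurry (H Q l)) := by
    simp only [hH_def]; split_ifs; exacts [hA l, hB l]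
  have hH01 Q l u v : H Q l u v ∈ Set.Icc (0 : ℝ) 1 := by
    simp only [hH_def]; split_ifs; exacts [hA01 l u v, hB01 l u v]
  have hint (Q : Finset (ι × ι)) : Integrable
      (fun v : ι → X => ∏ l ∈ P, H Q l (v l.1) (v l.2)) (Measure.pi fun _ => μ) := by
    refine integrable_of_abs_le (C := 1) (Finset.measurable_fun_prod _ fun l _ =>
      (hH Q l).comp (f := fun v : ι → X => (v l.1, v l.2)) (by fun_prop)) fun v => ?_
    have h01 := prod_mem_Icc_zero_one P fun l => hH01 Q l (v l.1) (v l.2)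
    rw [abs_of_nonneg h01.1]
    exact h01.2
  have hstep (Q : Finset (ι × ι)) (hQ : Q ⊆ P) :
      |∫ v : ι → X, ∏ l ∈ P, H Q l (v l.1) (v l.2) ∂(Measure.pi fun _ => μ) -
        ∫ v : ι → X, ∏ l ∈ P, H ∅ l (v l.1) (v l.2) ∂(Measure.pi fun _ => μ)| ≤ Q.card * ε := by
    induction Q using Finset.induction_on with
    | empty => simp
    | insert q Q hq ih =>
      have hqP : q ∈ P := hQ (Finset.mem_insert_self q Q)
      have hdiff : ∫ v : ι → X, ∏ l ∈ P, H (insert q Q) l (v l.1) (v l.2)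
            ∂(Measure.pi fun _ => μ) -
          ∫ v : ι → X, ∏ l ∈ P, H Q l (v l.1) (v l.2) ∂(Measure.pi fun _ => μ) =
          ∫ v : ι → X, (A q (v q.1) (v q.2) - B q (v q.1) (v q.2)) *
            ∏ l ∈ P.erase q, H Q l (v l.1) (v l.2) ∂(Measure.pi fun _ => μ) := by
        rw [← integral_sub (hint _) (hint _)]
        refine integral_congr_ae (ae_of_all _ fun v => ?_)
        have herase : ∏ l ∈ P.erase q, H (insert q Q) l (v l.1) (v l.2) =
            ∏ l ∈ P.erase q, H Q l (v l.1) (v l.2) :=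
          Finset.prod_congr rfl fun l hl => by
            simp only [hH_def, Finset.mem_insert, Finset.ne_of_mem_erase hl, false_or]
        have h1 : H (insert q Q) q = A q := if_pos (Finset.mem_insert_self q Q)
        have h2 : H Q q = B q := if_neg hq
        simp only
        rw [← Finset.mul_prod_erase P _ hqP, ← Finset.mul_prod_erase P _ hqP, herase, h1, h2,
          sub_mul]
      have hone : |∫ v : ι → X, (A q (v q.1) (v q.2) - B q (v q.1) (v q.2)) *
          ∏ l ∈ P.erase q, H Q l (v l.1) (v l.2) ∂(Measure.pi fun _ => μ)| ≤ ε := by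
        refine abs_integral_mul_prod_le (D := fun u v => A q u v - B q u v) (C := 1)
          ((hA q).sub (hB q)) (fun u v => ?_) (hε q) _ (hH Q) (hH01 Q) (hP q hqP).ne
          fun l hl => ?_
        · exact abs_sub_le_of_nonneg_of_le (hA01 q u v).1 (hA01 q u v).2 (hB01 q u v).1
            (hB01 q u v).2
        · obtain ⟨hne, hlP⟩ := Finset.mem_erase.1 hl
          have hlt := hP l hlP
          have hqlt := hP q hqP
          by_contra! hcon
          have h1 : l.1 = q.1 := by
            by_contra h
            have h2 := hcon.1 h
            exact hqlt.ne (h2.symm.trans (hcon.2 ((hlt.trans_eq h2).trans hqlt).ne))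
          exact hne (Prod.ext h1 (hcon.2 (h1.trans_ne hqlt.ne)))
      have := ih ((Finset.subset_insert q Q).trans hQ)
      rw [← hdiff] at hone
      rw [Finset.card_insert_of_notMem hq]
      push_cast
      calc _ ≤ _ := abs_sub_le _ (∫ v : ι → X, ∏ l ∈ P, H Q l (v l.1) (v l.2)
            ∂(Measure.pi fun _ => μ)) _
        _ ≤ ε + Q.card * ε := add_le_add hone this
        _ = (Q.card + 1) * ε := by ring
  have hPA (v : ι → X) : ∏ l ∈ P, H P l (v l.1) (v l.2) = ∏ l ∈ P, A l (v l.1) (v l.2) :=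
    Finset.prod_congr rfl fun l hl => by simp only [hH_def, if_pos hl]
  have hPB (v : ι → X) : ∏ l ∈ P, H ∅ l (v l.1) (v l.2) = ∏ l ∈ P, B l (v l.1) (v l.2) :=
    Finset.prod_congr rfl fun l hl => by simp only [hH_def, Finset.notMem_empty, if_false]
  simpa only [hPA, hPB] using hstep P subset_rfl

lemma card_filter_fst_lt_snd (k : ℕ) :
    (Finset.univ.filter fun p : Fin k × Fin k => p.1 < p.2).card = k.choose 2 := by
  rw [Finset.card_filter, Fintype.sum_prod_type_right]
  have h (j : Fin k) : ∑ i : Fin k, (if i < j then 1 else 0) = (j : ℕ) := by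
    rw [← Finset.card_filter, Finset.filter_gt_eq_Iio, Fin.card_Iio]
  simp only [h]
  rw [Fin.sum_univ_eq_sum_range (fun i => i) k, Finset.sum_range_id, Nat.choose_two_right]

/-- The factor that a pair of vertices, adjacent in `F` or not, contributes to `homDensity`. -/
def pairFactor (adj : Prop) (W : USq → USq → ℝ) (u v : USq) : ℝ :=
  (if adj then W u v else 1 - W u v) * (if (u.1 : ℝ) ≤ (v.1 : ℝ) then 1 else 0)

lemma measurable_pairFactor (adj : Prop) {W : USq → USq → ℝ} (hW : IsOrderon W) :
    Measurable (Function.uncurry (pairFactor adj W)) := by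
  have hWm : Measurable fun p : USq × USq => W p.1 p.2 := hW.1
  have hle : Measurable fun p : USq × USq => if (p.1.1 : ℝ) ≤ p.2.1 then (1 : ℝ) else 0 :=
    Measurable.ite (measurableSet_le (by fun_prop) (by fun_prop)) measurable_const measurable_const
  by_cases h : adj <;> simp only [Function.uncurry_def, pairFactor, h, if_true, if_false] <;>
    fun_prop

lemma pairFactor_mem_Icc (adj : Prop) {W : USq → USq → ℝ} (hW : IsOrderon W) (u v : USq) :
    pairFactor adj W u v ∈ Set.Icc (0 : ℝ) 1 := by
  have h := hW.2.1 u v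
  unfold pairFactor
  split_ifs <;> simp [h.1, h.2]

lemma abs_integral_pairFactor_sub_le (adj : Prop) {W U : USq → USq → ℝ}
    (hW : IsOrderon W) (hU : IsOrderon U) {f g : USq → ℝ}
    (hf : Measurable f) (hf01 : ∀ x, f x ∈ Set.Icc (0 : ℝ) 1)
    (hg : Measurable g) (hg01 : ∀ x, g x ∈ Set.Icc (0 : ℝ) 1) :
    |∫ p : USq × USq, (pairFactor adj W p.1 p.2 - pairFactor adj U p.1 p.2) * (f p.1 * g p.2)| ≤
      2 * √(cutNorm fun u v => W u v - U u v) := by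
  have key := abs_integral_mul_ite_le_le (D := fun u v => W u v - U u v) (hW.1.sub hU.1)
    (fun u v => abs_sub_le_of_nonneg_of_le (hW.2.1 u v).1 (hW.2.1 u v).2 (hU.2.1 u v).1
      (hU.2.1 u v).2) hf hf01 hg hg01
  by_cases h : adj
  · simpa only [pairFactor, h, if_true, ← sub_mul] using key
  · rw [← abs_neg, ← integral_neg]
    simpa only [pairFactor, h, if_false, ← sub_mul, ← neg_mul, sub_sub_sub_cancel_left,
      neg_sub] using key

end Counting

/-- Counting lemma, cut-norm version:
`|t(F,W) - t(F,U)| ≤ 2·k!·(k choose 2)·√(‖W - U‖_□)`. -/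
theorem counting_lemma_cutNorm {k : ℕ} (F : SimpleGraph (Fin k))
    (W U : USq → USq → ℝ) (hW : IsOrderon W) (hU : IsOrderon U) :
    |homDensity F W - homDensity F U| ≤
      2 * (k.factorial : ℝ) * (k.choose 2 : ℝ) *
        Real.sqrt (cutNorm (fun u v => W u v - U u v)) := by
  set P := Finset.univ.filter fun p : Fin k × Fin k => p.1 < p.2
  have h : |(∫ v : Fin k → USq, ∏ l ∈ P, pairFactor (F.Adj l.1 l.2) W (v l.1) (v l.2)) -
      ∫ v : Fin k → USq, ∏ l ∈ P, pairFactor (F.Adj l.1 l.2) U (v l.1) (v l.2)| ≤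
      P.card * (2 * √(cutNorm fun u v => W u v - U u v)) :=
    abs_integral_prod_sub_le (fun l hl => (Finset.mem_filter.1 hl).2)
      (fun l => measurable_pairFactor _ hW) (fun l => measurable_pairFactor _ hU)
      (fun l => pairFactor_mem_Icc _ hW) (fun l => pairFactor_mem_Icc _ hU)
      fun l f g hf hf01 hg hg01 => abs_integral_pairFactor_sub_le _ hW hU hf hf01 hg hg01
  rw [show P.card = k.choose 2 from card_filter_fst_lt_snd k] at h
  have hdens (V : USq → USq → ℝ) : homDensity F V = k.factorial *
      ∫ v : Fin k → USq, ∏ l ∈ P, pairFactor (F.Adj l.1 l.2) V (v l.1) (v l.2) := rfl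
  rw [hdens, hdens, ← mul_sub, abs_mul, Nat.abs_cast]
  calc _ ≤ (k.factorial : ℝ) * (k.choose 2 * (2 * √(cutNorm fun u v => W u v - U u v))) :=
        mul_le_mul_of_nonneg_left h (Nat.cast_nonneg _)
    _ = _ := by ring
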